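/- Let G be a finite simple graph, let t ≥ 1 and k ≥ 2 be integers such that G contains no K_{t,t} subgraph, let c > 0 be a real with k ≥ 2c such that G has 1-shallow-minor density at most c, set α = 1/k, ℓ = 4k³ + 1, q = 4k⁴, and let D' ⊆ V(G) have the k-cover property. Let D_2 be the set of all vertices u such that some maximal k-dominating-sequence of some vertex ends with u. Then |D_2| ≤ 2·(2k)^{t(2k+1)}·|D'|. -/

import Mathlib

open Finset

variable {V : Type*}

/-- `H` (on vertex set `Fin n`) is a 1-shallow minor of `G`: there are pairwise disjoint
branch sets, each inducing a connected subgraph of radius at most 1 (i.e. having a center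
adjacent to all its other vertices), such that edges of `H` are realized by edges of `G`
between the corresponding branch sets. -/
def IsOneShallowMinor (G : SimpleGraph V) {n : ℕ} (H : SimpleGraph (Fin n)) : Prop :=
  ∃ B : Fin n → Finset V,
    (∀ i, ∃ c ∈ B i, ∀ w ∈ B i, w = c ∨ G.Adj c w) ∧
    (∀ i j, i ≠ j → Disjoint (B i) (B j)) ∧
    (∀ i j, H.Adj i j → ∃ a ∈ B i, ∃ b ∈ B j, G.Adj a b)

/-- `G` has 1-shallow-minor density at most `c`: every 1-shallow minor `H` of `G`
satisfies `|E(H)| ≤ c * |V(H)|`. -/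
def DensityOneLE (G : SimpleGraph V) (c : ℝ) : Prop :=
  ∀ (n : ℕ) (H : SimpleGraph (Fin n)), IsOneShallowMinor G H →
    (Nat.card H.edgeSet : ℝ) ≤ c * n

/-- The closed neighborhood `N[v]` of a vertex as a `Finset`. -/
def closedNbhd [Fintype V] [DecidableEq V] (G : SimpleGraph V) [DecidableRel G.Adj]
    (v : V) : Finset V :=
  insert v (G.neighborFinset v)

/-- The list `L = (v₁, …, vₘ)` is a pseudo-cover of `W` with parameters `(α, ℓ, q, k)`. -/
def PseudoCover [Fintype V] [DecidableEq V] (G : SimpleGraph V) [DecidableRel G.Adj]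
    (α : ℝ) (ℓ q k : ℕ) (W : Finset V) (L : List V) : Prop :=
  L.length ≤ k ∧
  (W \ (L.toFinset.biUnion (closedNbhd G))).card ≤ q ∧
  ∀ i (hi : i < L.length),
    α * (((W \ ((L.take i).toFinset.biUnion (closedNbhd G))).card : ℝ)) ≤
      (((closedNbhd G (L.get ⟨i, hi⟩)) ∩
        (W \ ((L.take i).toFinset.biUnion (closedNbhd G)))).card : ℝ) ∧
    ℓ ≤ ((closedNbhd G (L.get ⟨i, hi⟩)) ∩
        (W \ ((L.take i).toFinset.biUnion (closedNbhd G)))).card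

/-- `𝒫(v)`: the set of vertices appearing in some pseudo-cover of `N(v)`,
when `|N(v)| > ℓ`, and `∅` otherwise. -/
def PCov [Fintype V] [DecidableEq V] (G : SimpleGraph V) [DecidableRel G.Adj]
    (α : ℝ) (ℓ q k : ℕ) (v : V) : Set V :=
  {u | ℓ < (G.neighborFinset v).card ∧
    ∃ L : List V, PseudoCover G α ℓ q k (G.neighborFinset v) L ∧ u ∈ L}

/-- `G` contains `K_{t,t}` as a subgraph. -/
def HasKtt (G : SimpleGraph V) (t : ℕ) : Prop :=
  ∃ A B : Finset V, Disjoint A B ∧ A.card = t ∧ B.card = t ∧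
    ∀ a ∈ A, ∀ b ∈ B, G.Adj a b

/-- `D'` has the `k`-cover property: for every vertex `v` there is `Z ⊆ D' \\ {v}`
with `|Z| ≤ k` and `N(v) ⊆ N[Z]`. -/
def KCoverProp [Fintype V] [DecidableEq V] (G : SimpleGraph V) [DecidableRel G.Adj]
    (D' : Finset V) (k : ℕ) : Prop :=
  ∀ v : V, ∃ Z : Finset V, Z ⊆ D'.erase v ∧ Z.card ≤ k ∧
    G.neighborFinset v ⊆ Z.biUnion (closedNbhd G)

/-- `(vs 1, …, vs s)` is a `k`-dominating-sequence of `v` (with parameters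
`α, ℓ, q, k, t`): the vertices are pairwise distinct, `vs 1 = v`, and there are sets
`B 1, …, B s` with `B 1 ⊆ N(vs 1)`, `B i ⊆ N(vs i) ∩ B (i-1)`,
`|B i| ≥ k^(t-i) * (2t - i + (t-i)q)` and `vs i ∈ 𝒫(vs (i-1))`. -/
def KDomSeq [Fintype V] [DecidableEq V] (G : SimpleGraph V) [DecidableRel G.Adj]
    (α : ℝ) (ℓ q k t : ℕ) (v : V) (s : ℕ) (vs : ℕ → V) : Prop :=
  1 ≤ s ∧ vs 1 = v ∧
  (∀ i j, 1 ≤ i → i < j → j ≤ s → vs i ≠ vs j) ∧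
  ∃ B : ℕ → Finset V,
    B 1 ⊆ G.neighborFinset (vs 1) ∧
    (∀ i, 2 ≤ i → i ≤ s → B i ⊆ G.neighborFinset (vs i) ∩ B (i - 1)) ∧
    (∀ i, 1 ≤ i → i ≤ s → k ^ (t - i) * (2 * t - i + (t - i) * q) ≤ (B i).card) ∧
    (∀ i, 2 ≤ i → i ≤ s → vs i ∈ PCov G α ℓ q k (vs (i - 1)))

/-- A maximal `k`-dominating-sequence: one that cannot be extended by any vertex. -/
def MaxKDomSeq [Fintype V] [DecidableEq V] (G : SimpleGraph V) [DecidableRel G.Adj]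
    (α : ℝ) (ℓ q k t : ℕ) (v : V) (s : ℕ) (vs : ℕ → V) : Prop :=
  KDomSeq G α ℓ q k t v s vs ∧
  ¬ ∃ u : V, KDomSeq G α ℓ q k t v (s + 1) (Function.update vs (s + 1) u)

/-- `D₂`: the set of all vertices `u` such that some maximal `k`-dominating-sequence of
some vertex ends with `u`. -/
def D2set [Fintype V] [DecidableEq V] (G : SimpleGraph V) [DecidableRel G.Adj]
    (α : ℝ) (ℓ q k t : ℕ) : Set V :=
  {u | ∃ (v : V) (s : ℕ) (vs : ℕ → V), MaxKDomSeq G α ℓ q k t v s vs ∧ vs s = u}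

section Density

variable [Fintype V] [DecidableEq V] {G : SimpleGraph V} [DecidableRel G.Adj]

/-- Bounded density of shallow minors bounds the degree sum of every induced subgraph. -/
lemma DensityOneLE.sum_card_inter_le {c : ℝ} (h : DensityOneLE G c) (X : Finset V) :
    (∑ x ∈ X, ((G.neighborFinset x ∩ X).card : ℝ)) ≤ 2 * c * X.card := by
  classical
  let e := X.equivFin
  let f : Fin X.card → V := fun i => (e.symm i : V)
  have hf : Function.Injective f := Subtype.val_injective.comp e.symm.injective
  have himg : Finset.univ.image f = X := by
    ext x
    simp only [Finset.mem_image, Finset.mem_univ, true_and]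
    constructor
    · rintro ⟨i, rfl⟩
      exact (e.symm i).2
    · intro hx
      exact ⟨e ⟨x, hx⟩, by simp [f]⟩
  let H : SimpleGraph (Fin X.card) := G.comap f
  have hminor : IsOneShallowMinor G H := by
    refine ⟨fun i => {f i}, fun i => ⟨f i, by simp, fun w hw => Or.inl (by simpa using hw)⟩,
      fun i j hij => ?_, fun i j hij => ⟨f i, by simp, f j, by simp, hij⟩⟩
    simpa using fun hfij => hij (hf hfij)
  have hdeg : ∀ i, H.degree i = (G.neighborFinset (f i) ∩ X).card := by
    intro i
    rw [← SimpleGraph.card_neighborFinset_eq_degree, ← Finset.card_image_of_injective _ hf]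
    congr 1
    ext x
    simp only [Finset.mem_image, SimpleGraph.mem_neighborFinset, Finset.mem_inter]
    constructor
    · rintro ⟨j, hj, rfl⟩
      exact ⟨hj, (e.symm j).2⟩
    · rintro ⟨hx, hxX⟩
      refine ⟨e ⟨x, hxX⟩, ?_, by simp [f]⟩
      change G.Adj (f i) (f (e ⟨x, hxX⟩))
      simpa [f] using hx
  have hsum : (∑ x ∈ X, ((G.neighborFinset x ∩ X).card : ℝ)) = 2 * Nat.card H.edgeSet := by
    have hE := H.sum_degrees_eq_twice_card_edges
    have hX : (∑ x ∈ X, (G.neighborFinset x ∩ X).card) = ∑ i, H.degree i := by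
      conv_lhs => rw [← himg]
      rw [Finset.sum_image hf.injOn]
      refine Finset.sum_congr rfl fun i _ => ?_
      rw [hdeg, himg]
    have hcard : Nat.card H.edgeSet = H.edgeFinset.card := by
      rw [Nat.card_eq_fintype_card, SimpleGraph.edgeFinset_card]
    rw [hcard]
    exact_mod_cast hX.trans hE
  have := h _ H hminor
  rw [hsum]
  linarith

variable (G) in
/-- The vertices that may be chosen next in a pseudo-cover with residual set `W`. -/
noncomputable def strongVertices (α : ℝ) (ℓ : ℕ) (W : Finset V) : Finset V := by
  classical
  exact Finset.univ.filter fun z =>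
    α * (W.card : ℝ) ≤ ((closedNbhd G z ∩ W).card : ℝ) ∧ ℓ ≤ (closedNbhd G z ∩ W).card

lemma DensityOneLE.card_strongVertices_le {c : ℝ} (h : DensityOneLE G c) {k : ℕ} (hk : 2 ≤ k)
    (hkc : 2 * c ≤ k) (W : Finset V) :
    (strongVertices G (1 / (k : ℝ)) (4 * k ^ 3 + 1) W).card ≤ 4 * k ^ 2 := by
  by_contra! hlt
  obtain ⟨A, hA, hAcard⟩ := Finset.exists_subset_card_eq (Nat.succ_le_of_lt hlt)
  have hstrong : ∀ z ∈ A, 1 / (k : ℝ) * W.card ≤ (closedNbhd G z ∩ W).card ∧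
      4 * k ^ 3 + 1 ≤ (closedNbhd G z ∩ W).card := fun z hz => by
    simpa [strongVertices] using hA hz
  have hne : A.Nonempty := Finset.card_pos.mp (by omega)
  obtain ⟨a, ha⟩ := hne
  have hW : 4 * k ^ 3 + 1 ≤ W.card :=
    (hstrong a ha).2.trans (Finset.card_le_card Finset.inter_subset_right)
  have hk0 : (2 : ℝ) ≤ k := by exact_mod_cast hk
  have hWR : 4 * (k : ℝ) ^ 3 + 1 ≤ W.card := by exact_mod_cast hW
  have hAR : (A.card : ℝ) = 4 * (k : ℝ) ^ 2 + 1 := by rw [hAcard]; push_cast; ring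
  have hlower : ∀ z ∈ A, (W.card : ℝ) / k - 1 ≤ (G.neighborFinset z ∩ (A ∪ W)).card := by
    intro z hz
    have h1 := (hstrong z hz).1
    have h2 : closedNbhd G z ∩ W ⊆ insert z (G.neighborFinset z ∩ (A ∪ W)) := by
      intro x hx
      simp only [closedNbhd, Finset.mem_inter, Finset.mem_insert, Finset.mem_union] at hx ⊢
      tauto
    have h3 : ((closedNbhd G z ∩ W).card : ℝ) ≤ (G.neighborFinset z ∩ (A ∪ W)).card + 1 := by
      exact_mod_cast (Finset.card_le_card h2).trans (Finset.card_insert_le _ _)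
    rw [one_div_mul_eq_div] at h1
    linarith
  have hsum := h.sum_card_inter_le (A ∪ W)
  have hsumA : (A.card : ℝ) * (W.card / k - 1) ≤ 2 * c * (A ∪ W).card := by
    refine le_trans ?_ hsum
    rw [← nsmul_eq_mul]
    refine (Finset.card_nsmul_le_sum A _ _ hlower).trans ?_
    exact Finset.sum_le_sum_of_subset_of_nonneg Finset.subset_union_left
      fun _ _ _ => Nat.cast_nonneg _
  have hunion : ((A ∪ W).card : ℝ) ≤ A.card + W.card := by
    exact_mod_cast Finset.card_union_le A W
  have hupper : 2 * c * ((A ∪ W).card : ℝ) ≤ k * (A.card + W.card) :=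
    (mul_le_mul_of_nonneg_right hkc (Nat.cast_nonneg _)).trans
      (mul_le_mul_of_nonneg_left hunion (by linarith))
  have hmain := hsumA.trans hupper
  rw [hAR] at hmain
  set w : ℝ := (W.card : ℝ)
  have hwk : 0 ≤ w / k := div_nonneg (Nat.cast_nonneg _) (by linarith)
  have hw : (4 * (k : ℝ) ^ 2) * (w / k) = 4 * k * w := by
    field_simp
  have h1 : 3 * (k : ℝ) * w ≤ (k + 1) * (4 * (k : ℝ) ^ 2 + 1) := by nlinarith
  have h2 : 3 * (k : ℝ) * (4 * (k : ℝ) ^ 3 + 1) ≤ 3 * (k : ℝ) * w := by gcongr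
  have h3 : (4 : ℝ) ≤ k ^ 2 := by nlinarith
  nlinarith [mul_le_mul_of_nonneg_right h3 (sq_nonneg (k : ℝ)),
    mul_le_mul_of_nonneg_right hk0 (pow_nonneg (by linarith : (0 : ℝ) ≤ k) 3)]

end Density

section PseudoCover

variable [Fintype V] [DecidableEq V] (G : SimpleGraph V) [DecidableRel G.Adj]

/-- The part of `W` not dominated by the vertices of the list `L`. -/
def residue (W : Finset V) (L : List V) : Finset V :=
  W \ L.toFinset.biUnion (closedNbhd G)

/-- The lists of length `n` that satisfy the strength condition of pseudo-covers of `W`. -/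
noncomputable def strongLists (α : ℝ) (ℓ : ℕ) (W : Finset V) : ℕ → Finset (List V)
  | 0 => {[]}
  | n + 1 => (strongLists α ℓ W n).biUnion fun p =>
      (strongVertices G α ℓ (residue G W p)).image fun z => p ++ [z]

variable {G}

lemma card_strongLists_le {α : ℝ} {ℓ N : ℕ}
    (hN : ∀ W, (strongVertices G α ℓ W).card ≤ N) (W : Finset V) (n : ℕ) :
    (strongLists G α ℓ W n).card ≤ N ^ n := by
  induction n with
  | zero => simp [strongLists]
  | succ n ih =>
    rw [strongLists, pow_succ]
    refine (Finset.card_biUnion_le_card_mul _ _ N fun p _ => ?_).trans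
      (Nat.mul_le_mul_right _ ih)
    exact Finset.card_image_le.trans (hN _)

lemma PseudoCover.getElem_mem_strongVertices {α : ℝ} {ℓ q k : ℕ} {W : Finset V} {L : List V}
    (h : PseudoCover G α ℓ q k W L) {i : ℕ} (hi : i < L.length) :
    L[i] ∈ strongVertices G α ℓ (residue G W (L.take i)) := by
  exact Finset.mem_filter.mpr ⟨Finset.mem_univ _, h.2.2 i hi⟩

lemma PseudoCover.take_mem_strongLists {α : ℝ} {ℓ q k : ℕ} {W : Finset V} {L : List V}
    (h : PseudoCover G α ℓ q k W L) (i : ℕ) (hi : i ≤ L.length) :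
    L.take i ∈ strongLists G α ℓ W i := by
  induction i with
  | zero => simp [strongLists]
  | succ i ih =>
    rw [strongLists, Finset.mem_biUnion]
    refine ⟨L.take i, ih (by omega), Finset.mem_image.mpr
      ⟨L[i], h.getElem_mem_strongVertices hi, ?_⟩⟩
    simp

lemma ncard_PCov_le {α : ℝ} {ℓ N : ℕ} (q k : ℕ) (hN1 : 1 ≤ N)
    (hN : ∀ W, (strongVertices G α ℓ W).card ≤ N) (v : V) :
    (PCov G α ℓ q k v).ncard ≤ k * N ^ k := by
  let W := G.neighborFinset v
  let U : Finset V := (Finset.range k).biUnion fun i =>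
    (strongLists G α ℓ W i).biUnion fun p => strongVertices G α ℓ (residue G W p)
  have hsub : PCov G α ℓ q k v ⊆ U := by
    rintro u ⟨-, L, hL, hu⟩
    obtain ⟨i, hi, rfl⟩ := List.mem_iff_getElem.mp hu
    simp only [U, Finset.mem_coe, Finset.mem_biUnion, Finset.mem_range]
    exact ⟨i, hi.trans_le hL.1, L.take i, hL.take_mem_strongLists i hi.le,
      hL.getElem_mem_strongVertices hi⟩
  have hU : U.card ≤ k * N ^ k := by
    refine (Finset.card_biUnion_le_card_mul _ _ (N ^ k) fun i hi => ?_).trans (by simp)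
    refine (Finset.card_biUnion_le_card_mul _ _ N fun p _ => hN _).trans ?_
    calc (strongLists G α ℓ W i).card * N ≤ N ^ i * N :=
          Nat.mul_le_mul_right _ (card_strongLists_le hN W i)
      _ = N ^ (i + 1) := (pow_succ _ _).symm
      _ ≤ N ^ k := Nat.pow_le_pow_right hN1 (Finset.mem_range.mp hi)
  calc (PCov G α ℓ q k v).ncard ≤ (U : Set V).ncard := Set.ncard_le_ncard hsub U.finite_toSet
    _ = U.card := Set.ncard_coe_finset U
    _ ≤ _ := hU

/-- If the closed neighborhoods of at most `k` vertices cover `R`, one of them contains at least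
a `1/k` fraction of `R`. -/
lemma exists_card_le_mul_card_inter {Z R : Finset V} {k : ℕ} (hZ : Z.card ≤ k)
    (hR : R ⊆ Z.biUnion (closedNbhd G)) (hpos : 0 < R.card) :
    ∃ z ∈ Z, R.card ≤ k * (closedNbhd G z ∩ R).card := by
  by_contra! hcon
  have hsub : R ⊆ Z.biUnion fun z => closedNbhd G z ∩ R := by
    intro x hx
    obtain ⟨z, hz, hxz⟩ := Finset.mem_biUnion.mp (hR hx)
    exact Finset.mem_biUnion.mpr ⟨z, hz, Finset.mem_inter.mpr ⟨hxz, hx⟩⟩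
  have hne : Z.Nonempty := by
    rw [Finset.nonempty_iff_ne_empty]
    rintro rfl
    simp only [Finset.biUnion_empty, Finset.subset_empty] at hR
    simp [hR] at hpos
  have h1 : R.card ≤ ∑ z ∈ Z, (closedNbhd G z ∩ R).card :=
    (Finset.card_le_card hsub).trans Finset.card_biUnion_le
  have h2 : k * ∑ z ∈ Z, (closedNbhd G z ∩ R).card < k * R.card := by
    rw [Finset.mul_sum]
    calc _ < ∑ _z ∈ Z, R.card := Finset.sum_lt_sum_of_nonempty hne hcon
      _ = Z.card * R.card := by simp
      _ ≤ _ := Nat.mul_le_mul_right _ hZ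
  exact absurd (Nat.lt_of_mul_lt_mul_left h2) (not_lt.mpr h1)

/-- A set covered by at most `k` vertices has a pseudo-cover consisting of such vertices. -/
lemma exists_pseudoCover {k : ℕ} (hk : 0 < k) {Z W : Finset V} (hZ : Z.card ≤ k)
    (hW : W ⊆ Z.biUnion (closedNbhd G)) :
    ∃ L : List V, L.toFinset ⊆ Z ∧
      PseudoCover G (1 / (k : ℝ)) (4 * k ^ 3 + 1) (4 * k ^ 4) k W L := by
  have hgreedy : ∀ n : ℕ, ∃ L : List V, L.Nodup ∧ L.toFinset ⊆ Z ∧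
      ((residue G W L).card ≤ 4 * k ^ 4 ∨ L.length = n) ∧
      ∀ i (hi : i < L.length), 1 / (k : ℝ) * ((residue G W (L.take i)).card : ℝ) ≤
          ((closedNbhd G L[i] ∩ residue G W (L.take i)).card : ℝ) ∧
        4 * k ^ 3 + 1 ≤ (closedNbhd G L[i] ∩ residue G W (L.take i)).card := by
    intro n
    induction n with
    | zero => exact ⟨[], by simp⟩
    | succ n ih =>
      obtain ⟨L, hnd, hLZ, hlen, hL⟩ := ih
      by_cases hres : (residue G W L).card ≤ 4 * k ^ 4
      · exact ⟨L, hnd, hLZ, Or.inl hres, hL⟩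
      have hn := hlen.resolve_left hres
      push Not at hres
      obtain ⟨z, hzZ, hz⟩ := exists_card_le_mul_card_inter (R := residue G W L) hZ
        (Finset.sdiff_subset.trans hW) (by omega)
      have hzl : 4 * k ^ 3 + 1 ≤ (closedNbhd G z ∩ residue G W L).card := by
        refine Nat.lt_of_mul_lt_mul_left (a := k) ?_
        calc k * (4 * k ^ 3) = 4 * k ^ 4 := by ring
          _ < _ := hres.trans_le hz
      have hzL : z ∉ L := by
        intro hmem
        obtain ⟨x, hx⟩ := Finset.card_pos.mp (lt_of_lt_of_le (Nat.succ_pos _) hzl)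
        obtain ⟨hxz, hxR⟩ := Finset.mem_inter.mp hx
        exact (Finset.mem_sdiff.mp hxR).2
          (Finset.mem_biUnion.mpr ⟨z, List.mem_toFinset.mpr hmem, hxz⟩)
      refine ⟨L ++ [z], ?_, ?_, Or.inr (by simp [hn]), ?_⟩
      · exact List.nodup_append.mpr ⟨hnd, by simp, by
          intro a ha b hb hab
          rw [List.mem_singleton] at hb
          exact hzL (hb ▸ hab ▸ ha)⟩
      · intro x hx
        rcases List.mem_append.mp (List.mem_toFinset.mp hx) with hx | hx
        · exact hLZ (List.mem_toFinset.mpr hx)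
        · rwa [List.mem_singleton.mp hx]
      · intro i hi
        rcases Nat.lt_or_ge i L.length with hiL | hiL
        · rw [List.getElem_append_left hiL, List.take_append_of_le_length hiL.le]
          exact hL i hiL
        · obtain rfl : i = L.length := by
            simp only [List.length_append, List.length_singleton] at hi
            omega
          simp only [List.getElem_concat_length, List.take_left]
          refine ⟨?_, hzl⟩
          rw [one_div_mul_eq_div, div_le_iff₀ (by exact_mod_cast hk), mul_comm]
          exact_mod_cast hz
  obtain ⟨L, hnd, hLZ, hlen, hL⟩ := hgreedy Z.card
  have hLcard : L.toFinset.card = L.length := List.toFinset_card_of_nodup hnd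
  refine ⟨L, hLZ, ?_, ?_, hL⟩
  · rw [← hLcard]
    exact (Finset.card_le_card hLZ).trans hZ
  · rcases hlen with h | h
    · exact h
    · rw [Finset.eq_of_subset_of_card_le hLZ (by omega), Finset.sdiff_eq_empty_iff_subset.mpr hW]
      simp

end PseudoCover

section DominatingSequences

variable [Fintype V] [DecidableEq V] {G : SimpleGraph V} [DecidableRel G.Adj]

/-- In a `K_{t,t}`-free graph every `k`-dominating-sequence is shorter than `t`. -/
lemma KDomSeq.lt_of_not_hasKtt {α : ℝ} {ℓ q k t s : ℕ} {v : V} {vs : ℕ → V} (ht : 1 ≤ t)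
    (hKtt : ¬ HasKtt G t) (h : KDomSeq G α ℓ q k t v s vs) : s < t := by
  obtain ⟨-, -, hinj, B, hB1, hB, hBcard, -⟩ := h
  by_contra! hts
  have hadj : ∀ j, j + 1 ≤ s → ∀ i, 1 ≤ i → i ≤ j + 1 → ∀ b ∈ B (j + 1), G.Adj (vs i) b := by
    intro j
    induction j with
    | zero =>
      intro _ i hi1 hi b hb
      obtain rfl : i = 1 := by omega
      simpa using hB1 hb
    | succ j ih =>
      intro hj i hi1 hi b hb
      have hb' := Finset.mem_inter.mp (hB (j + 2) (by omega) hj hb)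
      rcases Nat.lt_or_ge i (j + 2) with hlt | hge
      · exact ih (by omega) i hi1 (by omega) b hb'.2
      · obtain rfl : i = j + 2 := by omega
        simpa using hb'.1
  obtain ⟨j, rfl⟩ : ∃ j, t = j + 1 := ⟨t - 1, by omega⟩
  have hcard : j + 1 ≤ (B (j + 1)).card := by
    have := hBcard (j + 1) ht hts
    simp only [Nat.sub_self, pow_zero, one_mul, zero_mul, add_zero] at this
    omega
  obtain ⟨C, hCB, hC⟩ := Finset.exists_subset_card_eq hcard
  have hall : ∀ a ∈ (Finset.Icc 1 (j + 1)).image vs, ∀ b ∈ C, G.Adj a b := by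
    intro a ha b hb
    obtain ⟨i, hi, rfl⟩ := Finset.mem_image.mp ha
    rw [Finset.mem_Icc] at hi
    exact hadj j hts i hi.1 hi.2 b (hCB hb)
  refine hKtt ⟨(Finset.Icc 1 (j + 1)).image vs, C, ?_, ?_, hC, hall⟩
  · rw [Finset.disjoint_left]
    exact fun a ha haC => G.loopless.irrefl a (hall a ha a haC)
  · rw [Finset.card_image_of_injOn]
    · simp
    · intro a ha b hb hab
      simp only [Finset.coe_Icc, Set.mem_Icc] at ha hb
      rcases lt_trichotomy a b with hlt | rfl | hlt
      · exact absurd hab (hinj a b ha.1 hlt (hb.2.trans hts))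
      · rfl
      · exact absurd hab.symm (hinj b a hb.1 hlt (ha.2.trans hts))

/-- A `k`-dominating-sequence extends by a suitable vertex of `𝒫` that is not yet in it. -/
lemma KDomSeq.extend {α : ℝ} {ℓ q k t s : ℕ} {v u : V} {vs : ℕ → V} {B : ℕ → Finset V}
    {C : Finset V} (hs : 1 ≤ s) (h1 : vs 1 = v)
    (hinj : ∀ i j, 1 ≤ i → i < j → j ≤ s → vs i ≠ vs j)
    (hB1 : B 1 ⊆ G.neighborFinset (vs 1))
    (hB : ∀ i, 2 ≤ i → i ≤ s → B i ⊆ G.neighborFinset (vs i) ∩ B (i - 1))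
    (hBcard : ∀ i, 1 ≤ i → i ≤ s → k ^ (t - i) * (2 * t - i + (t - i) * q) ≤ (B i).card)
    (hP : ∀ i, 2 ≤ i → i ≤ s → vs i ∈ PCov G α ℓ q k (vs (i - 1)))
    (hu : ∀ i, 1 ≤ i → i ≤ s → vs i ≠ u) (huP : u ∈ PCov G α ℓ q k (vs s))
    (hC : C ⊆ G.neighborFinset u ∩ B s)
    (hCcard : k ^ (t - (s + 1)) * (2 * t - (s + 1) + (t - (s + 1)) * q) ≤ C.card) :
    KDomSeq G α ℓ q k t v (s + 1) (Function.update vs (s + 1) u) := by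
  have old : ∀ i, i ≤ s → Function.update vs (s + 1) u i = vs i := fun i hi =>
    Function.update_of_ne (by omega) _ _
  have oldB : ∀ i, i ≤ s → Function.update B (s + 1) C i = B i := fun i hi =>
    Function.update_of_ne (by omega) _ _
  refine ⟨by omega, by rw [old 1 hs, h1], ?_, Function.update B (s + 1) C, ?_, ?_, ?_, ?_⟩
  · intro i j hi hij hj
    rcases Nat.lt_or_ge s j with hlt | hge
    · obtain rfl : j = s + 1 := by omega
      rw [old i (by omega), Function.update_self]
      exact hu i hi (by omega)
    · rw [old i (by omega), old j hge]
      exact hinj i j hi hij hge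
  · rwa [old 1 hs, oldB 1 hs]
  · intro i hi his
    rcases Nat.lt_or_ge s i with hlt | hge
    · obtain rfl : i = s + 1 := by omega
      rw [Function.update_self, Function.update_self, Nat.add_sub_cancel, oldB s le_rfl]
      exact hC
    · rw [old i hge, oldB i hge, oldB (i - 1) (by omega)]
      exact hB i hi hge
  · intro i hi his
    rcases Nat.lt_or_ge s i with hlt | hge
    · obtain rfl : i = s + 1 := by omega
      rw [Function.update_self]
      exact hCcard
    · rw [oldB i hge]
      exact hBcard i hi hge
  · intro i hi his
    rcases Nat.lt_or_ge s i with hlt | hge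
    · obtain rfl : i = s + 1 := by omega
      rw [Function.update_self, Nat.add_sub_cancel, old s le_rfl]
      exact huP
    · rw [old i hge, old (i - 1) (by omega)]
      exact hP i hi hge

/-- Every maximal `k`-dominating-sequence meets a set with the `k`-cover property. -/
lemma MaxKDomSeq.exists_mem {k t s : ℕ} {v : V} {vs : ℕ → V} (ht : 1 ≤ t) (hk : 2 ≤ k)
    (hKtt : ¬ HasKtt G t) {D' : Finset V} (hD' : KCoverProp G D' k)
    (h : MaxKDomSeq G (1 / (k : ℝ)) (4 * k ^ 3 + 1) (4 * k ^ 4) k t v s vs) :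
    ∃ i, 1 ≤ i ∧ i ≤ s ∧ vs i ∈ D' := by
  obtain ⟨hseq, hmax⟩ := h
  have hst := hseq.lt_of_not_hasKtt ht hKtt
  obtain ⟨hs, h1, hinj, B, hB1, hB, hBcard, hP⟩ := hseq
  by_contra! hD
  obtain ⟨Z, hZD, hZk, hZ⟩ := hD' (vs s)
  obtain ⟨L, hLZ, hL⟩ := exists_pseudoCover (by omega : 0 < k) hZk hZ
  obtain ⟨r, rfl⟩ : ∃ r, t = s + 1 + r := ⟨t - (s + 1), by omega⟩
  have hBN : B s ⊆ G.neighborFinset (vs s) := by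
    rcases Nat.lt_or_ge s 2 with hlt | hge
    · obtain rfl : s = 1 := by omega
      exact hB1
    · exact (hB s hge le_rfl).trans Finset.inter_subset_left
  have hkr : 1 ≤ k ^ r := Nat.one_le_pow _ _ (by omega)
  have hBs : k * (k ^ r * (s + 1 + 2 * r + r * (4 * k ^ 4) + (1 + 4 * k ^ 4))) ≤ (B s).card := by
    refine le_trans (le_of_eq ?_) (hBcard s hs le_rfl)
    have e1 : s + 1 + r - s = r + 1 := by omega
    have e2 : 2 * (s + 1 + r) - s = s + 2 + 2 * r := by omega
    rw [e1, e2]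
    ring
  set P := k ^ r * (s + 1 + 2 * r + r * (4 * k ^ 4))
  have hBs' : k * (P + (1 + 4 * k ^ 4)) ≤ (B s).card := by
    refine le_trans (Nat.mul_le_mul_left _ ?_) hBs
    rw [mul_add]
    exact Nat.add_le_add le_rfl (Nat.le_mul_of_pos_left _ hkr)
  set R := B s ∩ L.toFinset.biUnion (closedNbhd G)
  have hRsub : R ⊆ L.toFinset.biUnion (closedNbhd G) := Finset.inter_subset_right
  have hsmall : (B s \ L.toFinset.biUnion (closedNbhd G)).card ≤ 4 * k ^ 4 :=
    (Finset.card_le_card (Finset.sdiff_subset_sdiff hBN subset_rfl)).trans hL.2.1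
  have hRcard : k * (P + 1) ≤ R.card := by
    have h2 : (B s).card ≤ R.card + 4 * k ^ 4 := by
      have : (B s \ L.toFinset.biUnion (closedNbhd G)).card + R.card = (B s).card :=
        Finset.card_sdiff_add_card_inter _ _
      omega
    have h3 : k * (P + (1 + 4 * k ^ 4)) = k * (P + 1) + k * (4 * k ^ 4) := by ring
    have h4 : 4 * k ^ 4 ≤ k * (4 * k ^ 4) := Nat.le_mul_of_pos_left _ (by omega)
    omega
  have hRpos : 0 < R.card := lt_of_lt_of_le (Nat.mul_pos (by omega) (Nat.succ_pos _)) hRcard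
  obtain ⟨u, huL, hu⟩ := exists_card_le_mul_card_inter
    ((Finset.card_le_card hLZ).trans hZk) hRsub hRpos
  have hulow : P + 1 ≤ (closedNbhd G u ∩ R).card :=
    Nat.le_of_mul_le_mul_left (hRcard.trans hu) (by omega)
  have huD : u ∈ D' := Finset.mem_of_mem_erase (hZD (hLZ huL))
  have hsubset : closedNbhd G u ∩ R ⊆ insert u (G.neighborFinset u ∩ B s) := by
    intro x hx
    obtain ⟨hxu, hxR⟩ := Finset.mem_inter.mp hx
    have hxB : x ∈ B s := (Finset.mem_inter.mp hxR).1
    rcases Finset.mem_insert.mp hxu with rfl | hxN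
    · exact Finset.mem_insert_self _ _
    · exact Finset.mem_insert_of_mem (Finset.mem_inter.mpr ⟨hxN, hxB⟩)
  have hC : P ≤ (G.neighborFinset u ∩ B s).card := by
    have := (Finset.card_le_card hsubset).trans (Finset.card_insert_le _ _)
    omega
  refine hmax ⟨u, KDomSeq.extend hs h1 hinj hB1 hB hBcard hP
    (fun i hi his hiu => hD i hi his (hiu ▸ huD)) ⟨?_, L, hL, List.mem_toFinset.mp huL⟩
    subset_rfl (le_trans (le_of_eq ?_) hC)⟩
  · have h5 : k * (1 + 4 * k ^ 4) ≤ k * (P + (1 + 4 * k ^ 4)) :=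
      Nat.mul_le_mul_left _ (Nat.le_add_left _ _)
    have h6 := Finset.card_le_card hBN
    have h7 : 2 * (1 + 4 * k ^ 4) ≤ k * (1 + 4 * k ^ 4) := Nat.mul_le_mul_right _ hk
    have h8 : k ^ 3 ≤ k ^ 4 := Nat.pow_le_pow_right (by omega) (by omega)
    omega
  · have e1 : s + 1 + r - (s + 1) = r := by omega
    have e2 : 2 * (s + 1 + r) - (s + 1) = s + 1 + 2 * r := by omega
    rw [e1, e2]

/-- The vertices reached from `D` by exactly `n` steps of the set-valued map `F`. -/
noncomputable def iterReach (F : V → Set V) (D : Finset V) : ℕ → Finset V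
  | 0 => D
  | n + 1 => (iterReach F D n).biUnion fun v => (Set.toFinite (F v)).toFinset

lemma card_iterReach_le {F : V → Set V} {M : ℕ} (hF : ∀ v, (F v).ncard ≤ M) (D : Finset V)
    (n : ℕ) : (iterReach F D n).card ≤ M ^ n * D.card := by
  induction n with
  | zero => simp [iterReach]
  | succ n ih =>
    rw [iterReach]
    refine (Finset.card_biUnion_le_card_mul _ _ M fun v _ => ?_).trans
      ((Nat.mul_le_mul_right M ih).trans (le_of_eq (by ring)))
    rw [← Set.ncard_eq_toFinset_card]
    exact hF v

lemma mem_iterReach {F : V → Set V} {D : Finset V} {vs : ℕ → V} {i s : ℕ} (hi : 1 ≤ i)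
    (hiD : vs i ∈ D) (hF : ∀ j, 2 ≤ j → j ≤ s → vs j ∈ F (vs (j - 1))) (n : ℕ)
    (hn : i + n ≤ s) : vs (i + n) ∈ iterReach F D n := by
  induction n with
  | zero => exact hiD
  | succ n ih =>
    rw [iterReach, Finset.mem_biUnion]
    exact ⟨vs (i + n), ih (by omega),
      (Set.Finite.mem_toFinset _).mpr (hF (i + (n + 1)) (by omega) hn)⟩

end DominatingSequences

/-- under the assumptions of the algorithm (`K_{t,t}`-free, density `≤ c`,
`k ≥ 2`, `k ≥ 2c`, `D'` with the `k`-cover property), the set `D₂` of last elements of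
maximal `k`-dominating-sequences satisfies `|D₂| ≤ 2·(2k)^(t(2k+1))·|D'|`. -/
theorem stmt11 [Fintype V] [DecidableEq V] (G : SimpleGraph V) [DecidableRel G.Adj]
    (t k : ℕ) (ht : 1 ≤ t) (hk : 2 ≤ k)
    (c : ℝ) (hc : 0 < c) (hkc : 2 * c ≤ (k : ℝ)) (hdens : DensityOneLE G c)
    (hKtt : ¬ HasKtt G t)
    (D' : Finset V) (hD' : KCoverProp G D' k) :
    (D2set G (1 / (k : ℝ)) (4 * k ^ 3 + 1) (4 * k ^ 4) k t).ncard ≤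
      2 * (2 * k) ^ (t * (2 * k + 1)) * D'.card := by
  classical
  set F := PCov G (1 / (k : ℝ)) (4 * k ^ 3 + 1) (4 * k ^ 4) k
  set M := (2 * k) ^ (2 * k + 1) with hM
  have hF : ∀ v, (F v).ncard ≤ M := by
    intro v
    refine (ncard_PCov_le (4 * k ^ 4) k (Nat.mul_pos (by norm_num) (pow_pos (by omega) 2))
      (hdens.card_strongVertices_le hk hkc) v).trans ?_
    have h1 : (4 * k ^ 2) ^ k = (2 * k) ^ (2 * k) := by
      rw [pow_mul (2 * k) 2 k]
      congr 1
      ring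
    rw [h1, hM, pow_succ, mul_comm]
    exact Nat.mul_le_mul_left _ (by omega)
  have hM2 : 2 ≤ M :=
    (by omega : 2 ≤ 2 * k).trans (Nat.le_self_pow (by omega) _)
  set U : Finset V := (Finset.range t).biUnion (iterReach F D') with hU
  have hsub : D2set G (1 / (k : ℝ)) (4 * k ^ 3 + 1) (4 * k ^ 4) k t ⊆ U := by
    rintro u ⟨v, s, vs, hmax, rfl⟩
    obtain ⟨i, hi, his, hiD⟩ := hmax.exists_mem ht hk hKtt hD'
    have hst := hmax.1.lt_of_not_hasKtt ht hKtt
    obtain ⟨-, -, -, B, -, -, -, hP⟩ := hmax.1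
    obtain ⟨n, rfl⟩ := Nat.exists_eq_add_of_le his
    simp only [hU, Finset.mem_coe, Finset.mem_biUnion, Finset.mem_range]
    exact ⟨n, by omega, mem_iterReach hi hiD hP n le_rfl⟩
  calc (D2set G (1 / (k : ℝ)) (4 * k ^ 3 + 1) (4 * k ^ 4) k t).ncard
      ≤ (U : Set V).ncard := Set.ncard_le_ncard hsub U.finite_toSet
    _ = U.card := Set.ncard_coe_finset U
    _ ≤ ∑ n ∈ Finset.range t, M ^ n * D'.card :=
        Finset.card_biUnion_le.trans
          (Finset.sum_le_sum fun n _ => card_iterReach_le hF D' n)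
    _ = (∑ n ∈ Finset.range t, M ^ n) * D'.card := (Finset.sum_mul _ _ _).symm
    _ ≤ M ^ t * D'.card := Nat.mul_le_mul_right _
        (Nat.geomSum_lt hM2 fun n hn => Finset.mem_range.mp hn).le
    _ ≤ 2 * (2 * k) ^ (t * (2 * k + 1)) * D'.card := by
        rw [hM, ← pow_mul, mul_comm (2 * k + 1) t]
        exact Nat.mul_le_mul_right _ (by omega)
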